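/- Let μ ≥ ν > -1. Then the following four functions are absolutely monotonic on [0, γ_{ν,1}⁴): f_{μ,ν}(x) = d/dx[log(x^{(ν-μ)/2}·e^{(x/16)(1/((μ+1)(μ+2)(μ+3)) - 1/((ν+1)(ν+2)(ν+3)))}·W_μ(x^{1/4})/W_ν(x^{1/4}))], g_{μ,ν}(x) = x^{(ν-μ)/2}·e^{(x/16)(1/((μ+1)(μ+2)(μ+3)) - 1/((ν+1)(ν+2)(ν+3)))}·W_μ(x^{1/4})/W_ν(x^{1/4}), h_ν(x) = d/dx[log(x^{ν/2+1/4}·e^{-x/(16(ν+1)(ν+2)(ν+3))}/W_ν(x^{1/4}))], and q_ν(x) = x^{ν/2+1/4}·e^{-x/(16(ν+1)(ν+2)(ν+3))}/W_ν(x^{1/4}). -/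

import Mathlib

open Real Set

/-- Bessel function of the first kind `J_ν(x)` (series definition, intended for `x > 0`). -/
noncomputable def besselJ (ν x : ℝ) : ℝ :=
  ∑' n : ℕ, (-1 : ℝ) ^ n * (x / 2) ^ (ν + 2 * (n : ℝ)) /
    ((n.factorial : ℝ) * Real.Gamma (ν + n + 1))

/-- Modified Bessel function of the first kind `I_ν(x)` (series definition, for `x > 0`). -/
noncomputable def besselI (ν x : ℝ) : ℝ :=
  ∑' n : ℕ, (x / 2) ^ (ν + 2 * (n : ℝ)) /
    ((n.factorial : ℝ) * Real.Gamma (ν + n + 1))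

/-- The cross-product `W_ν(x) = J_{ν+1}(x) I_ν(x) + J_ν(x) I_{ν+1}(x)`. -/
noncomputable def crossW (ν x : ℝ) : ℝ :=
  besselJ (ν + 1) x * besselI ν x + besselJ ν x * besselI (ν + 1) x

/-- The normalized cross-product `𝒲_ν`, an even entire function of `x`. -/
noncomputable def Wcal (ν x : ℝ) : ℝ :=
  ∑' n : ℕ, (-1 : ℝ) ^ n * (Real.Gamma (ν + 1) * Real.Gamma (ν + 2)) * x ^ (4 * n) /
    ((2 : ℝ) ^ (4 * n) * (n.factorial : ℝ) * Real.Gamma (ν + n + 1) * Real.Gamma (ν + 2 * n + 2))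

/-- The normalized Dini function `𝒟_ν`. -/
noncomputable def Dcal (ν x : ℝ) : ℝ :=
  ∑' n : ℕ, (-1 : ℝ) ^ n * (2 * (n : ℝ) + 1) * Real.Gamma (ν + 1) * x ^ (2 * n) /
    ((2 : ℝ) ^ (2 * n) * (n.factorial : ℝ) * Real.Gamma (ν + n + 1))

/-- The normalized modified Dini function `λ_ν`. -/
noncomputable def lamDini (ν x : ℝ) : ℝ :=
  ∑' n : ℕ, (2 * (n : ℝ) + 1) * Real.Gamma (ν + 1) * x ^ (2 * n) /
    ((2 : ℝ) ^ (2 * n) * (n.factorial : ℝ) * Real.Gamma (ν + n + 1))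

/-- The normalized Bessel function `𝒥_ν`. -/
noncomputable def Jcal (ν x : ℝ) : ℝ :=
  ∑' n : ℕ, (-1 : ℝ) ^ n * Real.Gamma (ν + 1) * x ^ (2 * n) /
    ((2 : ℝ) ^ (2 * n) * (n.factorial : ℝ) * Real.Gamma (ν + n + 1))

/-- The normalized modified Bessel function `𝓘_ν`. -/
noncomputable def Ical (ν x : ℝ) : ℝ :=
  ∑' n : ℕ, Real.Gamma (ν + 1) * x ^ (2 * n) /
    ((2 : ℝ) ^ (2 * n) * (n.factorial : ℝ) * Real.Gamma (ν + n + 1))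

/-- A function is absolutely monotonic on a set if it is infinitely differentiable there and
all of its (iterated) derivatives are nonnegative there. -/
def AbsolutelyMonotonicOn (f : ℝ → ℝ) (s : Set ℝ) : Prop :=
  ContDiffOn ℝ (⊤ : ℕ∞) f s ∧ ∀ (k : ℕ), ∀ x ∈ s, 0 ≤ iteratedDerivWithin k f s x

/-- Shorthand for `(ν+1)(ν+2)(ν+3)`. -/
noncomputable def Pnu (ν : ℝ) : ℝ := (ν + 1) * (ν + 2) * (ν + 3)

/-- `f_{μ,ν}`, extended by its limit value `0` at the origin. -/
noncomputable def fAM (μ ν : ℝ) (x : ℝ) : ℝ :=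
  if x = 0 then 0 else
    deriv (fun t : ℝ => Real.log (t ^ ((ν - μ) / 2) *
      Real.exp (t / 16 * (1 / Pnu μ - 1 / Pnu ν)) *
      crossW μ (t ^ (1/4 : ℝ)) / crossW ν (t ^ (1/4 : ℝ)))) x

/-- `g_{μ,ν}`, extended by its limit value at the origin. -/
noncomputable def gAM (μ ν : ℝ) (x : ℝ) : ℝ :=
  if x = 0 then
    (2 : ℝ) ^ (2 * ν) * Real.Gamma (ν + 1) * Real.Gamma (ν + 2) /
      ((2 : ℝ) ^ (2 * μ) * Real.Gamma (μ + 1) * Real.Gamma (μ + 2))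
  else
    x ^ ((ν - μ) / 2) * Real.exp (x / 16 * (1 / Pnu μ - 1 / Pnu ν)) *
      crossW μ (x ^ (1/4 : ℝ)) / crossW ν (x ^ (1/4 : ℝ))

/-- `h_ν`, extended by its limit value `0` at the origin. -/
noncomputable def hAM (ν : ℝ) (x : ℝ) : ℝ :=
  if x = 0 then 0 else
    deriv (fun t : ℝ => Real.log (t ^ (ν / 2 + 1/4 : ℝ) *
      Real.exp (-t / (16 * Pnu ν)) / crossW ν (t ^ (1/4 : ℝ)))) x

/-- `q_ν`, extended by its limit value at the origin. -/
noncomputable def qAM (ν : ℝ) (x : ℝ) : ℝ :=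
  if x = 0 then (2 : ℝ) ^ (2 * ν) * Real.Gamma (ν + 1) * Real.Gamma (ν + 2)
  else x ^ (ν / 2 + 1/4 : ℝ) * Real.exp (-x / (16 * Pnu ν)) / crossW ν (x ^ (1/4 : ℝ))


/-- value of a function whose Taylor coefficients at `x0` are nonnegative -/
lemma am_value_nonneg {f : ℝ → ℝ} {x0 : ℝ} {r : ENNReal} {p : FormalMultilinearSeries ℝ ℝ ℝ}
    (hf : HasFPowerSeriesOnBall f p x0 r) (h0 : ∀ k, 0 ≤ iteratedDeriv k f x0) {y : ℝ}
    (hy : x0 ≤ y) (hyr : y ∈ Metric.eball x0 r) : 0 ≤ f y := by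
  have h1 := hf.hasFPowerSeriesAt.eq_formalMultilinearSeries hf.analyticAt.hasFPowerSeriesAt
  have h2 := hf.hasSum_sub hyr
  refine h2.nonneg fun n => ?_
  rw [h1, FormalMultilinearSeries.ofScalars_apply_eq]
  have := h0 n
  have : 0 ≤ y - x0 := by linarith
  simp only [smul_eq_mul]
  positivity

lemma am_deriv_ball {f : ℝ → ℝ} {x0 : ℝ} {r : ENNReal} {p : FormalMultilinearSeries ℝ ℝ ℝ}
    (hf : HasFPowerSeriesOnBall f p x0 r) :
    ∃ q : FormalMultilinearSeries ℝ ℝ ℝ, HasFPowerSeriesOnBall (deriv f) q x0 r := by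
  have h := hf.fderiv
  exact ⟨_, (ContinuousLinearMap.apply ℝ ℝ (1:ℝ)).comp_hasFPowerSeriesOnBall h⟩

lemma am_iter_ball {f : ℝ → ℝ} {x0 : ℝ} {r : ENNReal} (k : ℕ)
    (hf : ∃ p : FormalMultilinearSeries ℝ ℝ ℝ, HasFPowerSeriesOnBall f p x0 r) :
    ∃ q : FormalMultilinearSeries ℝ ℝ ℝ, HasFPowerSeriesOnBall (iteratedDeriv k f) q x0 r := by
  induction k with
  | zero => simpa using hf
  | succ k ih =>
    obtain ⟨q, hq⟩ := ih
    rw [iteratedDeriv_succ]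
    exact am_deriv_ball hq

lemma iteratedDeriv_iteratedDeriv' (f : ℝ → ℝ) (n k : ℕ) :
    iteratedDeriv n (iteratedDeriv k f) = iteratedDeriv (n + k) f := by
  simp only [iteratedDeriv_eq_iterate, Function.iterate_add_apply]

lemma am_propagate {f : ℝ → ℝ} {ρ : ℝ} (hf : ∀ x ∈ Ico 0 ρ, AnalyticAt ℝ f x)
    (h0 : ∀ k, 0 ≤ iteratedDeriv k f 0) : ∀ x ∈ Ico 0 ρ, ∀ k, 0 ≤ iteratedDeriv k f x := by
  intro b hb
  let s : Set ℝ := {x | ∀ k, 0 ≤ iteratedDeriv k f x}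
  have hcl : IsClosed (s ∩ Icc 0 b) := by
    have : s ∩ Icc 0 b = Icc 0 b ∩ ⋂ k, (Icc 0 b ∩ (iteratedDeriv k f) ⁻¹' Ici 0) := by
      ext x; simp only [s, mem_inter_iff, mem_setOf_eq, mem_iInter, mem_preimage, mem_Ici]
      constructor
      · rintro ⟨h, h'⟩; exact ⟨h', fun k => ⟨h', h k⟩⟩
      · rintro ⟨h, h'⟩; exact ⟨fun k => (h' k).2, h⟩
    rw [this]
    refine isClosed_Icc.inter (isClosed_iInter fun k => ?_)
    refine ContinuousOn.preimage_isClosed_of_isClosed ?_ isClosed_Icc isClosed_Ici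
    intro x hx
    have hx' : AnalyticAt ℝ f x := hf x ⟨hx.1, lt_of_le_of_lt hx.2 hb.2⟩
    have := (am_iter_ball k ⟨_, hx'.choose_spec.choose_spec⟩).choose_spec.analyticAt
    exact this.continuousAt.continuousWithinAt
  have key : Icc 0 b ⊆ s := by
    refine hcl.Icc_subset_of_forall_mem_nhdsWithin h0 ?_
    rintro x ⟨hxs, hx⟩
    obtain ⟨p, r, hp⟩ := hf x ⟨hx.1, lt_trans hx.2 hb.2⟩
    have : Metric.eball x r ∩ Ioi x ∈ nhdsWithin x (Ioi x) :=
      Filter.inter_mem (mem_nhdsWithin_of_mem_nhds (Metric.eball_mem_nhds x hp.r_pos))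
        self_mem_nhdsWithin
    refine Filter.mem_of_superset this ?_
    rintro y ⟨hy, hy'⟩ k
    obtain ⟨q, hq⟩ := am_iter_ball k ⟨p, hp⟩
    refine am_value_nonneg hq (fun n => ?_) (le_of_lt hy') hy
    rw [iteratedDeriv_iteratedDeriv']
    exact hxs _
  exact key ⟨hb.1, le_refl b⟩

/-- logarithmic-derivative lemma: `G' = f G`. -/
lemma am_of_logDeriv {f G : ℝ → ℝ} (hf : AnalyticAt ℝ f 0) (hG : AnalyticAt ℝ G 0)
    (h : deriv G =ᶠ[nhds 0] fun x => f x * G x) (hG0 : 0 ≤ G 0)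
    (hf0 : ∀ k, 0 ≤ iteratedDeriv k f 0) : ∀ k, 0 ≤ iteratedDeriv k G 0 := by
  intro k
  induction k using Nat.strong_induction_on with
  | _ k ih =>
    cases k with
    | zero => simpa using hG0
    | succ n =>
      rw [iteratedDeriv_succ', h.iteratedDeriv_eq, iteratedDeriv_fun_mul hf.contDiffAt hG.contDiffAt]
      refine Finset.sum_nonneg fun i hi => ?_
      have h1 := hf0 i
      have h2 := ih (n - i) (by omega)
      positivity

noncomputable def tay (f : ℝ → ℝ) : PowerSeries ℝ :=
  PowerSeries.mk fun k => iteratedDeriv k f 0 / k.factorial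

lemma tay_mul {f g : ℝ → ℝ} (hf : AnalyticAt ℝ f 0) (hg : AnalyticAt ℝ g 0) :
    tay (fun x => f x * g x) = tay f * tay g := by
  ext n
  rw [PowerSeries.coeff_mul, Finset.Nat.sum_antidiagonal_eq_sum_range_succ_mk]
  simp only [tay, PowerSeries.coeff_mk]
  rw [iteratedDeriv_fun_mul hf.contDiffAt hg.contDiffAt, Finset.sum_div]
  refine Finset.sum_congr rfl fun i hi => ?_
  rw [Finset.mem_range] at hi
  rw [Nat.cast_choose ℝ (by omega : i ≤ n)]
  have := n.factorial_pos
  field_simp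

lemma tay_deriv (f : ℝ → ℝ) : tay (deriv f) = PowerSeries.derivative ℝ (tay f) := by
  ext n
  rw [PowerSeries.coeff_derivative]
  simp only [tay, PowerSeries.coeff_mk]
  rw [← iteratedDeriv_succ', Nat.factorial_succ]
  push_cast
  field_simp

lemma tay_congr {f g : ℝ → ℝ} (h : f =ᶠ[nhds 0] g) : tay f = tay g := by
  ext n; simp [tay, h.iteratedDeriv_eq]

lemma tay_of_hasFPowerSeriesAt {f : ℝ → ℝ} {c : ℕ → ℝ}
    (h : HasFPowerSeriesAt f (FormalMultilinearSeries.ofScalars ℝ c) 0) :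
    tay f = PowerSeries.mk c := by
  have := h.eq_formalMultilinearSeries h.analyticAt.hasFPowerSeriesAt
  rw [FormalMultilinearSeries.ofScalars_series_eq_iff] at this
  rw [this]; rfl

noncomputable def poch (a : ℝ) (n : ℕ) : ℝ := ∏ i ∈ Finset.range n, (a + i)

lemma poch_pos {a : ℝ} (ha : 0 < a) (n : ℕ) : 0 < poch a n :=
  Finset.prod_pos fun i _ => by positivity

lemma poch_zero (a : ℝ) : poch a 0 = 1 := by simp [poch]

lemma poch_succ (a : ℝ) (n : ℕ) : poch a (n + 1) = poch a n * (a + n) := by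
  simp [poch, Finset.prod_range_succ]

lemma poch_succ' (a : ℝ) (n : ℕ) : poch a (n + 1) = a * poch (a + 1) n := by
  simp only [poch, Finset.prod_range_succ']
  push_cast
  rw [mul_comm]
  simp [add_comm, add_left_comm]

lemma poch_shift {a : ℝ} (n : ℕ) : a * poch (a + 1) n = poch a n * (a + n) := by
  rw [← poch_succ', poch_succ]

noncomputable def fco (a b c : ℝ) (n : ℕ) : ℝ :=
  (-(1/64 : ℝ)) ^ n / (n.factorial * poch a n * poch b n * poch c n)

noncomputable def FS (a b c : ℝ) : PowerSeries ℝ := PowerSeries.mk (fco a b c)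

lemma FS_rot (a b c : ℝ) : FS b c a = FS a b c := by
  ext n; simp only [FS, PowerSeries.coeff_mk, fco]; ring_nf

lemma FS_const (a b c : ℝ) : PowerSeries.constantCoeff (FS a b c) = 1 := by
  rw [← PowerSeries.coeff_zero_eq_constantCoeff_apply]
  simp [FS, fco, poch_zero]

lemma FS_step {a b c : ℝ} (ha : 0 < a) (hb : 0 < b) (hc : 0 < c) :
    FS (a+1) b c = FS a b c + PowerSeries.C (1 / (64 * (a * (a+1) * b * c))) *
      (PowerSeries.X * FS (a+1+1) (b+1) (c+1)) := by
  ext n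
  rw [map_add, PowerSeries.coeff_C_mul]
  cases n with
  | zero => simp [FS, fco, poch_zero]
  | succ n =>
    rw [PowerSeries.coeff_succ_X_mul]
    simp only [FS, PowerSeries.coeff_mk, fco]
    have h1 : poch (a+1) (n+1) = (a+1) * poch (a+1+1) n := poch_succ' _ _
    have h2 : poch a (n+1) = a * poch (a+1) n := poch_succ' _ _
    have h3 : (a+1) * poch (a+1+1) n = poch (a+1) n * (a+1+n) := poch_shift n
    have h3' : poch (a+1+1) n = poch (a+1) n * (a+1+n) / (a+1) := by
      rw [← h3]; field_simp
    rw [h1, h2, poch_succ' b, poch_succ' c, h3', Nat.factorial_succ]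
    have p1 := poch_pos (a := a+1) (by linarith) n
    have p2 := poch_pos (a := b+1) (by linarith) n
    have p3 := poch_pos (a := c+1) (by linarith) n
    have p4 := n.factorial_pos
    have p5 : a + 1 + n ≠ 0 := by positivity
    push_cast
    field_simp
    ring

lemma FS_deriv {a b c : ℝ} (ha : 0 < a) (hb : 0 < b) (hc : 0 < c) :
    PowerSeries.derivative ℝ (FS a b c) =
      - (PowerSeries.C (1 / (64 * (a * b * c))) * FS (a+1) (b+1) (c+1)) := by
  ext n
  rw [PowerSeries.coeff_derivative, map_neg, PowerSeries.coeff_C_mul]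
  simp only [FS, PowerSeries.coeff_mk, fco]
  rw [poch_succ' a, poch_succ' b, poch_succ' c, Nat.factorial_succ]
  have p1 := poch_pos (a := a+1) (by linarith) n
  have p2 := poch_pos (a := b+1) (by linarith) n
  have p3 := poch_pos (a := c+1) (by linarith) n
  have p4 := n.factorial_pos
  push_cast
  field_simp
  ring

noncomputable def RS (a b c : ℝ) : PowerSeries ℝ := FS (a+1) b c * (FS a b c)⁻¹

lemma RS_mul (a b c : ℝ) : RS a b c * FS a b c = FS (a+1) b c := by
  rw [RS, mul_assoc, PowerSeries.inv_mul_cancel _ (by rw [FS_const]; norm_num), mul_one]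

lemma RS3 (a b c : ℝ) : RS a b c * RS b c (a+1) * RS c (a+1) (b+1) * FS a b c
    = FS (a+1) (b+1) (c+1) := by
  have h1 := RS_mul a b c
  have h2 := RS_mul b c (a+1)
  have h3 := RS_mul c (a+1) (b+1)
  rw [FS_rot] at h2
  rw [FS_rot (b+1) c (a+1), ← FS_rot (c+1) (a+1) (b+1)] at h3
  rw [show RS a b c * RS b c (a+1) * RS c (a+1) (b+1) * FS a b c
    = RS c (a+1) (b+1) * (RS b c (a+1) * (RS a b c * FS a b c)) by ring, h1, h2, ← h3]

lemma RS_rec {a b c : ℝ} (ha : 0 < a) (hb : 0 < b) (hc : 0 < c) :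
    RS a b c = 1 + PowerSeries.C (1 / (64 * (a * (a+1) * b * c))) * (PowerSeries.X *
      (RS a b c * RS b c (a+1) * RS c (a+1) (b+1) * RS (a+1) (b+1) (c+1))) := by
  have hne : FS a b c ≠ 0 := by
    intro h; have := FS_const a b c; rw [h] at this; simp at this
  apply mul_right_cancel₀ hne
  rw [RS_mul, FS_step ha hb hc, ← RS_mul (a+1) (b+1) (c+1), ← RS3 a b c]
  ring

/-- coefficientwise domination up to order `n` -/
def Dom (n : ℕ) (p q : PowerSeries ℝ) : Prop :=
  ∀ i ≤ n, 0 ≤ PowerSeries.coeff i p ∧ PowerSeries.coeff i p ≤ PowerSeries.coeff i q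

lemma Dom.mul {n : ℕ} {p q p' q' : PowerSeries ℝ} (h : Dom n p q) (h' : Dom n p' q') :
    Dom n (p * p') (q * q') := by
  intro i hi
  rw [PowerSeries.coeff_mul, PowerSeries.coeff_mul]
  have key : ∀ x ∈ Finset.HasAntidiagonal.antidiagonal i, x.1 ≤ n ∧ x.2 ≤ n := by
    intro x hx
    rw [Finset.HasAntidiagonal.mem_antidiagonal] at hx
    omega
  constructor
  · exact Finset.sum_nonneg fun x hx => mul_nonneg (h _ (key x hx).1).1 (h' _ (key x hx).2).1
  · exact Finset.sum_le_sum fun x hx => by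
      have h1 := h _ (key x hx).1
      have h2 := h' _ (key x hx).2
      exact mul_le_mul h1.2 h2.2 h2.1 (h1.1.trans h1.2)

lemma RS_coeff_zero (a b c : ℝ) : PowerSeries.coeff 0 (RS a b c) = 1 := by
  have h := congrArg (PowerSeries.constantCoeff (R := ℝ)) (RS_mul a b c)
  rw [map_mul, FS_const, FS_const, mul_one] at h
  rw [PowerSeries.coeff_zero_eq_constantCoeff_apply, h]

lemma RS_dom (n : ℕ) : ∀ {a b c a' b' c' : ℝ}, 0 < a → 0 < b → 0 < c → a ≤ a' → b ≤ b' → c ≤ c' →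
    Dom n (RS a' b' c') (RS a b c) := by
  induction n with
  | zero =>
    intro a b c a' b' c' _ _ _ _ _ _ i hi
    obtain rfl : i = 0 := by omega
    simp [RS_coeff_zero]
  | succ n ih =>
    intro a b c a' b' c' ha hb hc h1 h2 h3 i hi
    rcases Nat.lt_or_ge i (n+1) with hlt | hge
    · exact ih ha hb hc h1 h2 h3 i (by omega)
    obtain rfl : i = n + 1 := by omega
    have ha' : 0 < a' := by linarith
    have hb' : 0 < b' := by linarith
    have hc' : 0 < c' := by linarith
    have hD : Dom n (RS a' b' c' * RS b' c' (a'+1) * RS c' (a'+1) (b'+1) * RS (a'+1) (b'+1) (c'+1))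
        (RS a b c * RS b c (a+1) * RS c (a+1) (b+1) * RS (a+1) (b+1) (c+1)) := by
      refine (((ih ?_ ?_ ?_ ?_ ?_ ?_).mul (ih ?_ ?_ ?_ ?_ ?_ ?_)).mul (ih ?_ ?_ ?_ ?_ ?_ ?_)).mul
        (ih ?_ ?_ ?_ ?_ ?_ ?_) <;> linarith
    have hd := hD n le_rfl
    rw [RS_rec ha hb hc, RS_rec ha' hb' hc']
    simp only [map_add, PowerSeries.coeff_C_mul, PowerSeries.coeff_succ_X_mul,
      PowerSeries.coeff_one, Nat.succ_ne_zero, if_false, zero_add]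
    have hk : 1 / (64 * (a' * (a'+1) * b' * c')) ≤ 1 / (64 * (a * (a+1) * b * c)) := by
      apply one_div_le_one_div_of_le
      · positivity
      · gcongr
    refine ⟨mul_nonneg (by positivity) hd.1, mul_le_mul hk hd.2 hd.1 (by positivity)⟩

noncomputable def US (a b c : ℝ) : PowerSeries ℝ :=
  PowerSeries.C (1 / (64 * (a * b * c))) * (RS a b c * RS b c (a+1) * RS c (a+1) (b+1))

lemma US_mul {a b c : ℝ} (ha : 0 < a) (hb : 0 < b) (hc : 0 < c) :
    PowerSeries.derivative ℝ (FS a b c) = - (US a b c * FS a b c) := by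
  rw [FS_deriv ha hb hc, US, ← RS3]; ring

lemma US_dom (n : ℕ) {a b c a' b' c' : ℝ} (ha : 0 < a) (hb : 0 < b) (hc : 0 < c)
    (h1 : a ≤ a') (h2 : b ≤ b') (h3 : c ≤ c') :
    0 ≤ PowerSeries.coeff n (US a' b' c') ∧
      PowerSeries.coeff n (US a' b' c') ≤ PowerSeries.coeff n (US a b c) := by
  have ha' : 0 < a' := by linarith
  have hb' : 0 < b' := by linarith
  have hc' : 0 < c' := by linarith
  have hD : Dom n (RS a' b' c' * RS b' c' (a'+1) * RS c' (a'+1) (b'+1))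
      (RS a b c * RS b c (a+1) * RS c (a+1) (b+1)) := by
    refine ((RS_dom n ?_ ?_ ?_ ?_ ?_ ?_).mul (RS_dom n ?_ ?_ ?_ ?_ ?_ ?_)).mul
      (RS_dom n ?_ ?_ ?_ ?_ ?_ ?_) <;> linarith
  have hd := hD n le_rfl
  simp only [US, PowerSeries.coeff_C_mul]
  have hk : 1 / (64 * (a' * b' * c')) ≤ 1 / (64 * (a * b * c)) := by
    apply one_div_le_one_div_of_le
    · positivity
    · gcongr
  exact ⟨mul_nonneg (by positivity) hd.1, mul_le_mul hk hd.2 hd.1 (by positivity)⟩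

lemma US_coeff_zero (a b c : ℝ) : PowerSeries.coeff 0 (US a b c) = 1 / (64 * (a * b * c)) := by
  have h := RS_coeff_zero
  simp only [PowerSeries.coeff_zero_eq_constantCoeff_apply] at h
  simp [US, h]

lemma entire_aux {c : ℕ → ℝ} {K : ℝ} (hc : ∀ n, c n ≠ 0)
    (hK : ∀ n, |c (n+1)| ≤ K / ((n : ℝ) + 1) * |c n|) :
    (FormalMultilinearSeries.ofScalars ℝ c).radius = ⊤ := by
  refine FormalMultilinearSeries.ofScalars_radius_eq_top_of_tendsto ℝ c
    (Filter.Eventually.of_forall hc) ?_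
  have h1 : Filter.Tendsto (fun n : ℕ => K / ((n : ℝ) + 1)) Filter.atTop (nhds 0) := by
    have := (tendsto_one_div_add_atTop_nhds_zero_nat (𝕜 := ℝ)).const_mul K
    simpa [div_eq_mul_inv] using this
  refine squeeze_zero (fun n => by positivity) (fun n => ?_) h1
  rw [div_le_iff₀ (norm_pos_iff.mpr (hc n))]
  exact hK n

lemma entire_ball {c : ℕ → ℝ} {K : ℝ} (hc : ∀ n, c n ≠ 0)
    (hK : ∀ n, |c (n+1)| ≤ K / ((n : ℝ) + 1) * |c n|) :
    HasFPowerSeriesOnBall (fun x => ∑' n, c n * x ^ n)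
      (FormalMultilinearSeries.ofScalars ℝ c) 0 ⊤ := by
  have hr := entire_aux hc hK
  have h := (FormalMultilinearSeries.ofScalars ℝ c).hasFPowerSeriesOnBall (by rw [hr]; simp)
  rw [hr] at h
  refine h.congr fun x _ => ?_
  simp [FormalMultilinearSeries.sum, mul_comm]

lemma entire_summable {c : ℕ → ℝ} {K : ℝ} (hc : ∀ n, c n ≠ 0)
    (hK : ∀ n, |c (n+1)| ≤ K / ((n : ℝ) + 1) * |c n|) (x : ℝ) :
    Summable fun n => ‖c n * x ^ n‖ := by
  have hr := entire_aux hc hK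
  have := (FormalMultilinearSeries.ofScalars ℝ c).summable_norm_apply (x := x) (by rw [hr]; simp)
  simpa only [FormalMultilinearSeries.ofScalars_apply_eq, smul_eq_mul] using this

noncomputable def jco (ν : ℝ) (n : ℕ) : ℝ :=
  (-1 : ℝ) ^ n / ((n.factorial : ℝ) * Real.Gamma (ν + n + 1))

noncomputable def ico (ν : ℝ) (n : ℕ) : ℝ :=
  1 / ((n.factorial : ℝ) * Real.Gamma (ν + n + 1))

lemma gam_pos {ν : ℝ} (hν : -1 < ν) (n : ℕ) : 0 < Real.Gamma (ν + n + 1) :=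
  Real.Gamma_pos_of_pos (by have : (0:ℝ) ≤ n := n.cast_nonneg; linarith)

lemma gam_succ {ν : ℝ} (hν : -1 < ν) (n : ℕ) :
    Real.Gamma (ν + (n + 1) + 1) = (ν + n + 1) * Real.Gamma (ν + n + 1) := by
  have : (0:ℝ) ≤ n := n.cast_nonneg
  rw [← Real.Gamma_add_one (by linarith)]
  ring_nf

lemma ico_pos {ν : ℝ} (hν : -1 < ν) (n : ℕ) : 0 < ico ν n := by
  have := gam_pos hν n
  have := n.factorial_pos
  unfold ico; positivity

lemma jco_eq (ν : ℝ) (n : ℕ) : jco ν n = (-1) ^ n * ico ν n := by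
  unfold jco ico; ring

lemma jco_ne {ν : ℝ} (hν : -1 < ν) (n : ℕ) : jco ν n ≠ 0 := by
  rw [jco_eq]; have := ico_pos hν n
  exact mul_ne_zero (by simp) this.ne'

lemma abs_jco (ν : ℝ) (n : ℕ) : |jco ν n| = |ico ν n| := by
  rw [jco_eq, abs_mul]; simp

lemma ico_bound {ν : ℝ} (hν : -1 < ν) (n : ℕ) :
    |ico ν (n+1)| ≤ (1 / (ν + 1)) / ((n : ℝ) + 1) * |ico ν n| := by
  rw [abs_of_pos (ico_pos hν _), abs_of_pos (ico_pos hν _)]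
  have hn : (0:ℝ) ≤ n := n.cast_nonneg
  have hg := gam_pos hν n
  have h1 : ico ν (n+1) = (1 / (ν + n + 1)) / ((n : ℝ) + 1) * ico ν n := by
    unfold ico
    rw [Nat.factorial_succ]
    push_cast
    rw [gam_succ hν]
    have : ν + n + 1 ≠ 0 := by linarith
    have := n.factorial_pos
    field_simp
  rw [h1]
  have := (ico_pos hν n).le
  have h3 : 0 < ν + 1 := by linarith
  gcongr
  linarith

lemma jco_bound {ν : ℝ} (hν : -1 < ν) (n : ℕ) :
    |jco ν (n+1)| ≤ (1 / (ν + 1)) / ((n : ℝ) + 1) * |jco ν n| := by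
  rw [abs_jco, abs_jco]; exact ico_bound hν n

lemma ico_shift {ν : ℝ} (hν : -1 < ν) (n : ℕ) : (n + ν + 1) * ico (ν + 1) n = ico ν n := by
  have hn : (0:ℝ) ≤ n := n.cast_nonneg
  have hg := gam_pos hν n
  unfold ico
  rw [show ν + 1 + n + 1 = ν + (n + 1) + 1 by ring, gam_succ hν]
  have : ν + n + 1 ≠ 0 := by linarith
  have := n.factorial_pos
  field_simp
  ring

lemma ico_deriv (ν : ℝ) (n : ℕ) : ico ν (n + 1) * (n + 1) = ico (ν + 1) n := by
  unfold ico
  rw [Nat.factorial_succ]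
  push_cast
  rw [show ν + 1 + n + 1 = ν + (n + 1) + 1 by ring]
  have := n.factorial_pos
  field_simp

lemma coeff_X_deriv (f : PowerSeries ℝ) (n : ℕ) :
    PowerSeries.coeff n (PowerSeries.X * PowerSeries.derivative ℝ f)
      = n * PowerSeries.coeff n f := by
  cases n with
  | zero => simp
  | succ n =>
    rw [PowerSeries.coeff_succ_X_mul, PowerSeries.coeff_derivative]
    push_cast; ring

noncomputable def AS (ν : ℝ) : PowerSeries ℝ := PowerSeries.mk (jco ν)
noncomputable def BS (ν : ℝ) : PowerSeries ℝ := PowerSeries.mk (ico ν)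
noncomputable def WS (ν : ℝ) : PowerSeries ℝ := AS (ν + 1) * BS ν + AS ν * BS (ν + 1)

lemma AS_deriv (ν : ℝ) : PowerSeries.derivative ℝ (AS ν) = - AS (ν + 1) := by
  ext n
  rw [PowerSeries.coeff_derivative, map_neg]
  simp only [AS, PowerSeries.coeff_mk, jco_eq]
  rw [← ico_deriv]; ring

lemma BS_deriv (ν : ℝ) : PowerSeries.derivative ℝ (BS ν) = BS (ν + 1) := by
  ext n
  rw [PowerSeries.coeff_derivative]
  simp only [BS, PowerSeries.coeff_mk]
  rw [← ico_deriv]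

lemma AS_ode {ν : ℝ} (hν : -1 < ν) : PowerSeries.X * PowerSeries.derivative ℝ (AS (ν + 1)) =
    AS ν - PowerSeries.C (ν + 1) * AS (ν + 1) := by
  ext n
  rw [coeff_X_deriv, map_sub, PowerSeries.coeff_C_mul]
  simp only [AS, PowerSeries.coeff_mk, jco_eq]
  rw [← ico_shift hν]; ring

lemma BS_ode {ν : ℝ} (hν : -1 < ν) : PowerSeries.X * PowerSeries.derivative ℝ (BS (ν + 1)) =
    BS ν - PowerSeries.C (ν + 1) * BS (ν + 1) := by
  ext n
  rw [coeff_X_deriv, map_sub, PowerSeries.coeff_C_mul]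
  simp only [BS, PowerSeries.coeff_mk]
  rw [← ico_shift hν]; ring

lemma WS_eq1 {ν : ℝ} (hν : -1 < ν) (n : ℕ) : (n + ν + 1) * PowerSeries.coeff n (WS ν) =
    2 * PowerSeries.coeff n (AS ν * BS ν) := by
  have h : PowerSeries.X * PowerSeries.derivative ℝ (WS ν) =
      PowerSeries.C 2 * (AS ν * BS ν) - PowerSeries.C (ν + 1) * WS ν := by
    have h2 : (PowerSeries.C (2:ℝ)) = 2 := map_ofNat _ 2
    have hA := AS_ode hν
    have hB := BS_ode hν
    unfold WS
    generalize PowerSeries.C (ν + 1) = κ at *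
    simp only [map_add, Derivation.leibniz, smul_eq_mul, AS_deriv ν, BS_deriv ν, h2]
    linear_combination BS ν * hA + AS ν * hB
  have := congrArg (PowerSeries.coeff n) h
  rw [coeff_X_deriv, map_sub, PowerSeries.coeff_C_mul, PowerSeries.coeff_C_mul] at this
  linarith

lemma WS_eq2 {ν : ℝ} (hν : -1 < ν) : PowerSeries.X * PowerSeries.derivative ℝ
    (PowerSeries.derivative ℝ (AS ν * BS ν)) =
      - (PowerSeries.C 2 * (PowerSeries.X * (AS (ν + 1) * BS (ν + 1)))) -
        PowerSeries.C (ν + 1) * PowerSeries.derivative ℝ (AS ν * BS ν) := by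
  have h2 : (PowerSeries.C (2:ℝ)) = 2 := map_ofNat _ 2
  have hA := AS_ode hν
  have hB := BS_ode hν
  generalize PowerSeries.C (ν + 1) = κ at *
  simp only [map_add, map_neg, Derivation.leibniz, smul_eq_mul, AS_deriv ν, BS_deriv ν, h2]
  linear_combination - BS ν * hA + AS ν * hB

lemma WS_eq2' {ν : ℝ} (hν : -1 < ν) (n : ℕ) :
    (n + 2) * (n + 2 + ν) * PowerSeries.coeff (n + 2) (AS ν * BS ν) =
      - 2 * PowerSeries.coeff n (AS (ν + 1) * BS (ν + 1)) := by
  have := congrArg (PowerSeries.coeff (n+1)) (WS_eq2 hν)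
  rw [coeff_X_deriv, map_sub, map_neg, PowerSeries.coeff_C_mul, PowerSeries.coeff_C_mul,
    PowerSeries.coeff_succ_X_mul, PowerSeries.coeff_derivative] at this
  push_cast at this
  linear_combination this

lemma WS_eq2_one {ν : ℝ} (hν : -1 < ν) : PowerSeries.coeff 1 (AS ν * BS ν) = 0 := by
  have := congrArg (PowerSeries.coeff 0) (WS_eq2 hν)
  rw [coeff_X_deriv, map_sub, map_neg, PowerSeries.coeff_C_mul, PowerSeries.coeff_C_mul,
    PowerSeries.coeff_derivative] at this
  simp only [PowerSeries.coeff_zero_X_mul] at this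
  have h : (ν + 1) ≠ 0 := by linarith
  have h2 : (ν + 1) * PowerSeries.coeff 1 (AS ν * BS ν) = 0 := by
    push_cast at this
    simp only [zero_add] at this
    linear_combination this
  exact (mul_eq_zero.mp h2).resolve_left h

lemma WS_eq3 {ν : ℝ} (hν : -1 < ν) (n : ℕ) :
    (n + 2 * ν + 2) * PowerSeries.coeff n (AS (ν + 1) * BS (ν + 1)) =
      PowerSeries.coeff n (WS ν) := by
  have h : PowerSeries.X * PowerSeries.derivative ℝ (AS (ν + 1) * BS (ν + 1)) =
      WS ν - PowerSeries.C (2 * (ν + 1)) * (AS (ν + 1) * BS (ν + 1)) := by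
    have h2 : (PowerSeries.C (2:ℝ)) = 2 := map_ofNat _ 2
    have hA := AS_ode hν
    have hB := BS_ode hν
    unfold WS
    rw [map_mul PowerSeries.C, h2]
    generalize PowerSeries.C (ν + 1) = κ at *
    simp only [Derivation.leibniz, smul_eq_mul]
    linear_combination BS (ν+1) * hA + AS (ν+1) * hB
  have := congrArg (PowerSeries.coeff n) h
  rw [coeff_X_deriv, map_sub, PowerSeries.coeff_C_mul] at this
  linarith

lemma WS_rec {ν : ℝ} (hν : -1 < ν) (n : ℕ) : PowerSeries.coeff (n + 2) (WS ν) =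
    - 4 * PowerSeries.coeff n (WS ν) /
      ((n + 2) * (n + 2 + ν) * (n + 3 + ν) * (n + 2 + 2 * ν)) := by
  have hn : (0:ℝ) ≤ n := n.cast_nonneg
  have h1 := WS_eq1 hν (n+2)
  have h2 := WS_eq2' hν n
  have h3 := WS_eq3 hν n
  push_cast at h1
  have p1 : (0:ℝ) < n + 2 := by linarith
  have p2 : (0:ℝ) < n + 2 + ν := by linarith
  have p3 : (0:ℝ) < n + 3 + ν := by linarith
  have p4 : (0:ℝ) < n + 2 + 2 * ν := by linarith
  rw [eq_div_iff (by positivity), ← h3]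
  linear_combination (n + 2) * (n + 2 + ν) * (n + 2 + 2 * ν) * h1 + 2 * (n + 2 + 2 * ν) * h2

lemma WS_odd {ν : ℝ} (hν : -1 < ν) (m : ℕ) : PowerSeries.coeff (2 * m + 1) (WS ν) = 0 := by
  induction m with
  | zero =>
    have h1 := WS_eq1 hν 1
    rw [WS_eq2_one hν] at h1
    push_cast at h1
    have : (1 + ν + 1) ≠ 0 := by linarith
    simpa [this] using h1
  | succ m ih =>
    rw [show 2 * (m + 1) + 1 = 2 * m + 1 + 2 by ring, WS_rec hν, ih]; simp

lemma WS_even {ν : ℝ} (hν : -1 < ν) (m : ℕ) : PowerSeries.coeff (2 * m) (WS ν) =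
    2 / (Real.Gamma (ν + 1) * Real.Gamma (ν + 2)) * 16 ^ m *
      fco (ν + 1) ((ν + 2) / 2) ((ν + 3) / 2) m := by
  induction m with
  | zero =>
    simp only [mul_zero, WS, map_add, PowerSeries.coeff_mul, Finset.HasAntidiagonal.antidiagonal_zero,
      Finset.sum_singleton, AS, BS, PowerSeries.coeff_mk, jco, ico, fco, poch_zero]
    have e : ν + 1 + 1 = ν + 2 := by ring
    simp [e]
    ring
  | succ m ih =>
    rw [show 2 * (m + 1) = 2 * m + 2 by ring, WS_rec hν, ih]
    unfold fco
    rw [poch_succ, poch_succ, poch_succ, Nat.factorial_succ]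
    have hn : (0:ℝ) ≤ m := m.cast_nonneg
    have q1 := poch_pos (a := ν+1) (by linarith) m
    have q2 := poch_pos (a := (ν+2)/2) (by linarith) m
    have q3 := poch_pos (a := (ν+3)/2) (by linarith) m
    have q4 := m.factorial_pos
    have p1 : (ν + 1 + m) ≠ 0 := by linarith
    have p2 : ((ν + 2)/2 + m) ≠ 0 := by linarith
    have p3 : ((ν + 3)/2 + m) ≠ 0 := by linarith
    have e1 : ((2 * m : ℕ) : ℝ) + 2 + ν = 2 * ((ν + 2)/2 + m) := by push_cast; ring
    have e2 : ((2 * m : ℕ) : ℝ) + 3 + ν = 2 * ((ν + 3)/2 + m) := by push_cast; ring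
    have e3 : ((2 * m : ℕ) : ℝ) + 2 + 2 * ν = 2 * (ν + 1 + m) := by push_cast; ring
    have e4 : ((2 * m : ℕ) : ℝ) + 2 = 2 * (m + 1) := by push_cast; ring
    rw [e1, e2, e3, e4]
    have g1 := Real.Gamma_pos_of_pos (s := ν + 1) (by linarith)
    have g2 := Real.Gamma_pos_of_pos (s := ν + 2) (by linarith)
    push_cast
    generalize (ν + 1 + (m:ℝ)) = P1 at *
    generalize ((ν + 2)/2 + (m:ℝ)) = P2 at *
    generalize ((ν + 3)/2 + (m:ℝ)) = P3 at *
    field_simp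
    ring

noncomputable def phi (ν z : ℝ) : ℝ := ∑' n, fco (ν + 1) ((ν + 2) / 2) ((ν + 3) / 2) n * z ^ n

lemma besselJ_eq {ν x : ℝ} (hx : 0 < x) :
    besselJ ν x = (x / 2) ^ ν * ∑' n, jco ν n * ((x / 2) ^ 2) ^ n := by
  unfold besselJ
  rw [← tsum_mul_left]
  refine tsum_congr fun n => ?_
  rw [Real.rpow_add (by positivity), show (2 * (n:ℝ)) = ((2 * n : ℕ) : ℝ) by push_cast; ring,
    Real.rpow_natCast, pow_mul, jco]
  ring

lemma besselI_eq {ν x : ℝ} (hx : 0 < x) :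
    besselI ν x = (x / 2) ^ ν * ∑' n, ico ν n * ((x / 2) ^ 2) ^ n := by
  unfold besselI
  rw [← tsum_mul_left]
  refine tsum_congr fun n => ?_
  rw [Real.rpow_add (by positivity), show (2 * (n:ℝ)) = ((2 * n : ℕ) : ℝ) by push_cast; ring,
    Real.rpow_natCast, pow_mul, ico]
  ring

lemma cauchy_eval {a b : ℕ → ℝ} {t : ℝ} (ha : Summable fun n => ‖a n * t ^ n‖)
    (hb : Summable fun n => ‖b n * t ^ n‖) :
    HasSum (fun n => PowerSeries.coeff n (PowerSeries.mk a * PowerSeries.mk b) * t ^ n)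
      ((∑' n, a n * t ^ n) * ∑' n, b n * t ^ n) := by
  have h1 := tsum_mul_tsum_eq_tsum_sum_antidiagonal_of_summable_norm ha hb
  have h2 := (summable_norm_sum_mul_antidiagonal_of_summable_norm ha hb).of_norm
  have h3 := h2.hasSum
  rw [← h1] at h3
  rw [show (fun n => PowerSeries.coeff n (PowerSeries.mk a * PowerSeries.mk b) * t ^ n) = _ from
    funext fun n => ?_]
  · exact h3
  rw [PowerSeries.coeff_mul, Finset.sum_mul]
  refine Finset.sum_congr rfl fun k hk => ?_
  rw [Finset.HasAntidiagonal.mem_antidiagonal] at hk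
  simp only [PowerSeries.coeff_mk]
  rw [← hk, pow_add]; ring

lemma crossW_eq {ν x : ℝ} (hν : -1 < ν) (hx : 0 < x) :
    crossW ν x = (x / 2) ^ (2 * ν + 1) * (2 / (Real.Gamma (ν + 1) * Real.Gamma (ν + 2))) *
      phi ν (x ^ 4) := by
  have hν1 : -1 < ν + 1 := by linarith
  set t : ℝ := (x / 2) ^ 2 with ht
  have j0 := entire_summable (jco_ne hν) (jco_bound hν) t
  have j1 := entire_summable (jco_ne hν1) (jco_bound hν1) t
  have i0 := entire_summable (fun n => (ico_pos hν n).ne') (ico_bound hν) t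
  have i1 := entire_summable (fun n => (ico_pos hν1 n).ne') (ico_bound hν1) t
  have hs := (cauchy_eval j1 i0).add (cauchy_eval j0 i1)
  have hs' : HasSum (fun n => PowerSeries.coeff n (WS ν) * t ^ n)
      ((∑' n, jco (ν+1) n * t ^ n) * (∑' n, ico ν n * t ^ n) +
       (∑' n, jco ν n * t ^ n) * ∑' n, ico (ν+1) n * t ^ n) := by
    convert hs using 2 with n
    simp only [WS, AS, BS, map_add, add_mul]
  have hinj : Function.Injective (fun m : ℕ => 2 * m) := fun a b h => by
    simp only at h; omega
  have hW : (∑' n, PowerSeries.coeff n (WS ν) * t ^ n) =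
      (2 / (Real.Gamma (ν + 1) * Real.Gamma (ν + 2))) * phi ν (x ^ 4) := by
    rw [← hinj.tsum_eq]
    · rw [phi, ← tsum_mul_left]
      refine tsum_congr fun m => ?_
      rw [WS_even hν, ht]
      rw [show ((x/2)^2)^(2*m) = (x^4)^m / 16^m by
        rw [← div_pow, ← pow_mul, show 2 * (2 * m) = 4 * m by ring, pow_mul]
        congr 1; ring]
      field_simp
    · intro n hn
      rcases Nat.even_or_odd' n with ⟨k, rfl | rfl⟩
      · exact ⟨k, rfl⟩
      · exact absurd (by simp [WS_odd hν]) hn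
  rw [mul_assoc, ← hW, hs'.tsum_eq, crossW, besselJ_eq hx, besselJ_eq hx, besselI_eq hx,
    besselI_eq hx, show 2 * ν + 1 = ν + 1 + ν by ring, Real.rpow_add (by positivity) (ν + 1) ν,
    ← ht]
  ring


lemma tay_add {f g : ℝ → ℝ} (hf : AnalyticAt ℝ f 0) (hg : AnalyticAt ℝ g 0) :
    tay (fun x => f x + g x) = tay f + tay g := by
  ext n
  simp only [tay, PowerSeries.coeff_mk, map_add]
  rw [← add_div, ← iteratedDeriv_add hf.contDiffAt hg.contDiffAt]
  rfl

lemma tay_sub {f g : ℝ → ℝ} (hf : AnalyticAt ℝ f 0) (hg : AnalyticAt ℝ g 0) :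
    tay (fun x => f x - g x) = tay f - tay g := by
  ext n
  simp only [tay, PowerSeries.coeff_mk, map_sub]
  rw [← sub_div, ← iteratedDeriv_sub hf.contDiffAt hg.contDiffAt]
  rfl

lemma tay_const (c : ℝ) : tay (fun _ => c) = PowerSeries.C c := by
  ext n
  simp only [tay, PowerSeries.coeff_mk, iteratedDeriv_const, PowerSeries.coeff_C]
  split_ifs with h
  · simp [h]
  · simp

lemma deriv_nonneg_of_tay {f : ℝ → ℝ} (h : ∀ k, 0 ≤ PowerSeries.coeff k (tay f)) (k : ℕ) :
    0 ≤ iteratedDeriv k f 0 := by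
  have h1 := h k
  simp only [tay, PowerSeries.coeff_mk] at h1
  have h2 : (0:ℝ) < k.factorial := by exact_mod_cast k.factorial_pos
  have := mul_nonneg h1 h2.le
  rwa [div_mul_cancel₀ _ h2.ne'] at this

lemma fco_ne {a b c : ℝ} (ha : 0 < a) (hb : 0 < b) (hc : 0 < c) (n : ℕ) : fco a b c n ≠ 0 := by
  have p1 := poch_pos ha n
  have p2 := poch_pos hb n
  have p3 := poch_pos hc n
  have := n.factorial_pos
  unfold fco
  refine div_ne_zero (pow_ne_zero _ (by norm_num)) (by positivity)

lemma fco_bound {a b c : ℝ} (ha : 0 < a) (hb : 0 < b) (hc : 0 < c) (n : ℕ) :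
    |fco a b c (n+1)| ≤ (1 / (64 * (a * b * c))) / ((n : ℝ) + 1) * |fco a b c n| := by
  have p1 := poch_pos ha n
  have p2 := poch_pos hb n
  have p3 := poch_pos hc n
  have p4 := n.factorial_pos
  have h : fco a b c (n+1) = -((1 / (64 * ((a + n) * (b + n) * (c + n)))) / ((n : ℝ) + 1)
      * fco a b c n) := by
    unfold fco
    rw [poch_succ, poch_succ, poch_succ, Nat.factorial_succ]
    have q1 : a + n ≠ 0 := by positivity
    have q2 : b + n ≠ 0 := by positivity
    have q3 : c + n ≠ 0 := by positivity
    push_cast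
    field_simp
    ring
  rw [h, abs_neg, abs_mul, abs_of_nonneg (by positivity)]
  gcongr <;> simp

lemma phi_ball {ν : ℝ} (hν : -1 < ν) : HasFPowerSeriesOnBall (phi ν)
    (FormalMultilinearSeries.ofScalars ℝ (fco (ν + 1) ((ν + 2) / 2) ((ν + 3) / 2))) 0 ⊤ := by
  have h1 : 0 < ν + 1 := by linarith
  have h2 : 0 < (ν + 2) / 2 := by linarith
  have h3 : 0 < (ν + 3) / 2 := by linarith
  exact entire_ball (fco_ne h1 h2 h3) (fco_bound h1 h2 h3)

lemma phi_analytic {ν : ℝ} (hν : -1 < ν) (x : ℝ) : AnalyticAt ℝ (phi ν) x :=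
  (phi_ball hν).analyticOnNhd x (by simp)

lemma phi_tay {ν : ℝ} (hν : -1 < ν) : tay (phi ν) = FS (ν + 1) ((ν + 2) / 2) ((ν + 3) / 2) :=
  tay_of_hasFPowerSeriesAt (phi_ball hν).hasFPowerSeriesAt

lemma phi_zero (ν : ℝ) : phi ν 0 = 1 := by
  unfold phi
  rw [tsum_eq_single 0 (fun n hn => by simp [hn])]
  simp [fco, poch_zero]

noncomputable def LD (ν x : ℝ) : ℝ := deriv (phi ν) x / phi ν x

lemma LD_analytic {ν x : ℝ} (hν : -1 < ν) (hx : phi ν x ≠ 0) : AnalyticAt ℝ (LD ν) x :=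
  (phi_analytic hν x).deriv.div (phi_analytic hν x) hx

lemma phi_ev_ne {ν x : ℝ} (hν : -1 < ν) (hx : phi ν x ≠ 0) : ∀ᶠ y in nhds x, phi ν y ≠ 0 :=
  (phi_analytic hν x).continuousAt.eventually_ne hx

lemma LD_tay {ν : ℝ} (hν : -1 < ν) :
    tay (LD ν) = - US (ν + 1) ((ν + 2) / 2) ((ν + 3) / 2) := by
  have h0 : phi ν 0 ≠ 0 := by simp [phi_zero]
  have h1 : tay (fun x => LD ν x * phi ν x) = tay (deriv (phi ν)) := by
    apply tay_congr
    filter_upwards [phi_ev_ne hν h0] with y hy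
    simp [LD, hy]
  rw [tay_mul (LD_analytic hν h0) (phi_analytic hν 0), tay_deriv, phi_tay hν,
    US_mul (by linarith) (by linarith) (by linarith), ← neg_mul] at h1
  refine mul_right_cancel₀ ?_ h1
  intro h; have := FS_const (ν + 1) ((ν + 2) / 2) ((ν + 3) / 2); rw [h] at this; simp at this

lemma US0 (ν : ℝ) : PowerSeries.coeff 0 (US (ν + 1) ((ν + 2) / 2) ((ν + 3) / 2)) =
    1 / (16 * Pnu ν) := by
  rw [US_coeff_zero, Pnu]; congr 1; ring

lemma LD_zero {ν : ℝ} (hν : -1 < ν) : LD ν 0 = - (1 / (16 * Pnu ν)) := by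
  have h := congrArg (PowerSeries.coeff 0) (LD_tay hν)
  rw [map_neg, US0] at h
  simpa [tay] using h

lemma absmono_of {f F : ℝ → ℝ} {ρ : ℝ} (hρ : 0 < ρ) (hf : ∀ x ∈ Ico 0 ρ, AnalyticAt ℝ f x)
    (h0 : ∀ k, 0 ≤ iteratedDeriv k f 0) (hF : EqOn F f (Ico 0 ρ)) :
    AbsolutelyMonotonicOn F (Ico 0 ρ) := by
  have hp := am_propagate hf h0
  refine ⟨ContDiffOn.congr (fun x hx => (hf x hx).contDiffAt.contDiffWithinAt) hF, ?_⟩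
  intro k x hx
  rw [iteratedDerivWithin_congr hF hx,
    iteratedDerivWithin_eq_iteratedDeriv (uniqueDiffOn_Ico 0 ρ) (hf x hx).contDiffAt hx]
  exact hp x hx k

lemma finish {f G raw : ℝ → ℝ} {ρ : ℝ} (hρ : 0 < ρ) (hf : ∀ x ∈ Ico 0 ρ, AnalyticAt ℝ f x)
    (hG : ∀ x ∈ Ico 0 ρ, AnalyticAt ℝ G x)
    (hd : ∀ x ∈ Ico 0 ρ, deriv G =ᶠ[nhds x] fun y => f y * G y)
    (hpos : ∀ x ∈ Ico 0 ρ, 0 < G x) (hf0 : f 0 = 0) (ht : ∀ k, 0 ≤ PowerSeries.coeff k (tay f))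
    (hraw : EqOn raw G (Ioo 0 ρ)) :
    AbsolutelyMonotonicOn (fun x => if x = 0 then 0 else deriv (fun t => Real.log (raw t)) x)
      (Ico 0 ρ) ∧
    AbsolutelyMonotonicOn (fun x => if x = 0 then G 0 else raw x) (Ico 0 ρ) := by
  have z : (0:ℝ) ∈ Ico 0 ρ := ⟨le_rfl, hρ⟩
  have hf' := deriv_nonneg_of_tay ht
  constructor
  · refine absmono_of hρ hf hf' ?_
    intro x hx
    by_cases hx0 : x = 0
    · simp [hx0, hf0]
    · have hx' : x ∈ Ioo 0 ρ := ⟨lt_of_le_of_ne hx.1 (Ne.symm hx0), hx.2⟩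
      simp only [hx0, if_false]
      have e : (fun t => Real.log (raw t)) =ᶠ[nhds x] fun t => Real.log (G t) := by
        filter_upwards [Ioo_mem_nhds hx'.1 hx'.2] with y hy
        rw [hraw hy]
      rw [e.deriv_eq, deriv.log (hG x hx).differentiableAt (hpos x hx).ne', (hd x hx).eq_of_nhds]
      field_simp [(hpos x hx).ne']
  · refine absmono_of hρ hG (am_of_logDeriv (hf 0 z) (hG 0 z) (hd 0 z) (hpos 0 z).le hf') ?_
    intro x hx
    by_cases hx0 : x = 0
    · simp [hx0]
    · have hx' : x ∈ Ioo 0 ρ := ⟨lt_of_le_of_ne hx.1 (Ne.symm hx0), hx.2⟩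
      simp only [hx0, if_false]
      exact hraw hx'

lemma crossW_root {ν x : ℝ} (hν : -1 < ν) (hx : 0 < x) :
    crossW ν (x ^ (1/4 : ℝ)) = x ^ (ν / 2 + 1/4 : ℝ) *
      (1 / ((2:ℝ) ^ (2 * ν) * Real.Gamma (ν + 1) * Real.Gamma (ν + 2))) * phi ν x := by
  have hy : 0 < x ^ (1/4 : ℝ) := Real.rpow_pos_of_pos hx _
  have h4 : (x ^ (1/4 : ℝ)) ^ 4 = x := by
    rw [← Real.rpow_natCast, ← Real.rpow_mul hx.le]; norm_num
  have h5 : (x ^ (1/4 : ℝ) / 2) ^ (2 * ν + 1) = x ^ (ν / 2 + 1/4 : ℝ) / ((2:ℝ) ^ (2 * ν) * 2) := by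
    rw [Real.div_rpow hy.le (by norm_num), ← Real.rpow_mul hx.le,
      Real.rpow_add (by norm_num : (0:ℝ) < 2), Real.rpow_one]
    congr 2; ring
  rw [crossW_eq hν hy, h4, h5]
  have g1 := Real.Gamma_pos_of_pos (s := ν + 1) (by linarith)
  have g2 := Real.Gamma_pos_of_pos (s := ν + 2) (by linarith)
  have g3 : 0 < (2:ℝ) ^ (2 * ν) := by positivity
  field_simp

lemma phi_deriv_at {ν : ℝ} (hν : -1 < ν) {y : ℝ} (hy : phi ν y ≠ 0) :
    HasDerivAt (phi ν) (LD ν y * phi ν y) y := by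
  have := (phi_analytic hν y).differentiableAt.hasDerivAt
  rwa [show deriv (phi ν) y = LD ν y * phi ν y by simp [LD, hy]] at this

/-- For `μ ≥ ν > -1`, the functions `f_{μ,ν}`, `g_{μ,ν}`, `h_ν` and `q_ν` are absolutely
monotonic on `[0, γ_{ν,1}⁴)`, where `γ_{ν,1}` is the smallest positive zero of `W_ν`. -/
theorem fghq_absolutely_monotonic (μ ν : ℝ) (hν : -1 < ν) (hμν : ν ≤ μ) (γ1 : ℝ)
    (hγ1pos : 0 < γ1) (hγ1zero : crossW ν γ1 = 0)
    (hγ1min : ∀ x : ℝ, 0 < x → crossW ν x = 0 → γ1 ≤ x) :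
    AbsolutelyMonotonicOn (fAM μ ν) (Set.Ico 0 (γ1 ^ 4)) ∧
    AbsolutelyMonotonicOn (gAM μ ν) (Set.Ico 0 (γ1 ^ 4)) ∧
    AbsolutelyMonotonicOn (hAM ν) (Set.Ico 0 (γ1 ^ 4)) ∧
    AbsolutelyMonotonicOn (qAM ν) (Set.Ico 0 (γ1 ^ 4)) := by
  set ρ := γ1 ^ 4 with hρdef
  have hρ : 0 < ρ := by positivity
  have hμ : -1 < μ := by linarith
  have z : (0:ℝ) ∈ Ico 0 ρ := ⟨le_rfl, hρ⟩
  have nz : ∀ x ∈ Ico 0 ρ, phi ν x ≠ 0 := by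
    intro y hy h
    have hy0 : 0 < y := by
      rcases eq_or_lt_of_le hy.1 with h' | h'
      · rw [← h', phi_zero] at h; norm_num at h
      · exact h'
    have hp : 0 < y ^ (1/4 : ℝ) := Real.rpow_pos_of_pos hy0 _
    have h1 := hγ1min _ hp (by rw [crossW_root hν hy0, h, mul_zero])
    have h4 : (y ^ (1/4 : ℝ)) ^ 4 = y := by
      rw [← Real.rpow_natCast, ← Real.rpow_mul hy0.le]; norm_num
    have h5 : ρ ≤ y := by rw [← h4, hρdef]; gcongr
    exact absurd hy.2 (not_lt.mpr h5)
  have cont : ∀ {κ : ℝ}, -1 < κ → Continuous (phi κ) := fun hκ =>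
    continuous_iff_continuousAt.mpr fun x => (phi_analytic hκ x).continuousAt
  have pos : ∀ x ∈ Ico 0 ρ, 0 < phi ν x := by
    intro x hx
    by_contra hneg
    obtain ⟨y, hy, hy'⟩ := intermediate_value_Icc' hx.1 (cont hν).continuousOn
      (show (0:ℝ) ∈ Icc (phi ν x) (phi ν 0) from ⟨not_lt.mp hneg, by rw [phi_zero]; norm_num⟩)
    exact nz y ⟨hy.1, lt_of_le_of_lt hy.2 hx.2⟩ hy'
  -- constants
  have g1 := Real.Gamma_pos_of_pos (s := ν + 1) (by linarith)
  have g2 := Real.Gamma_pos_of_pos (s := ν + 2) (by linarith)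
  have g3 : 0 < (2:ℝ) ^ (2 * ν) := by positivity
  have g4 := Real.Gamma_pos_of_pos (s := μ + 1) (by linarith)
  have g5 := Real.Gamma_pos_of_pos (s := μ + 2) (by linarith)
  have g6 : 0 < (2:ℝ) ^ (2 * μ) := by positivity
  have hPν : 0 < Pnu ν := by
    have : 0 < ν + 1 := by linarith
    have : 0 < ν + 2 := by linarith
    have : 0 < ν + 3 := by linarith
    unfold Pnu; positivity
  have hPμ : 0 < Pnu μ := by
    have : 0 < μ + 1 := by linarith
    have : 0 < μ + 2 := by linarith
    have : 0 < μ + 3 := by linarith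
    unfold Pnu; positivity
  have lin : ∀ (c x : ℝ), AnalyticAt ℝ (fun x => Real.exp (c * x)) x := by
    intro c x; fun_prop
  have dlin : ∀ (c x : ℝ), HasDerivAt (fun x => Real.exp (c * x)) (Real.exp (c * x) * c) x := by
    intro c x
    simpa using ((hasDerivAt_id x).const_mul c).exp
  have dom := fun n => US_dom n (a := ν+1) (b := (ν+2)/2) (c := (ν+3)/2) (a' := μ+1)
    (b' := (μ+2)/2) (c' := (μ+3)/2) (by linarith) (by linarith) (by linarith) (by linarith)
    (by linarith) (by linarith)
  have h0ν : phi ν 0 ≠ 0 := nz 0 z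
  have h0μ : phi μ 0 ≠ 0 := by simp [phi_zero]
  -- the pair h, q
  let c1 : ℝ := -(1 / (16 * Pnu ν))
  let K1 : ℝ := (2 : ℝ) ^ (2 * ν) * Real.Gamma (ν + 1) * Real.Gamma (ν + 2)
  have hK1 : 0 < K1 := by positivity
  have H1 := finish (f := fun x => c1 - LD ν x) (G := fun x => K1 * (Real.exp (c1 * x) / phi ν x))
    (raw := fun x => x ^ (ν / 2 + 1/4 : ℝ) * Real.exp (-x / (16 * Pnu ν)) /
      crossW ν (x ^ (1/4 : ℝ))) hρ
    (fun x hx => analyticAt_const.sub (LD_analytic hν (nz x hx)))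
    (fun x hx => analyticAt_const.mul ((lin c1 x).div (phi_analytic hν x) (nz x hx)))
    (by
      intro x hx
      filter_upwards [phi_ev_ne hν (nz x hx)] with y hy
      refine ((((dlin c1 y).div (phi_deriv_at hν hy) hy).const_mul K1).deriv).trans ?_
      field_simp)
    (fun x hx => by have := pos x hx; positivity)
    (by simp only [LD_zero hν, c1]; ring)
    (by
      intro k
      rw [tay_sub analyticAt_const (LD_analytic hν h0ν), tay_const, LD_tay hν, sub_neg_eq_add,
        map_add, PowerSeries.coeff_C]
      split_ifs with hk
      · rw [hk, US0]; simp [c1]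
      · have := dom k; linarith)
    (by
      intro x hx
      have hx0 : 0 < x := hx.1
      have hp := Real.rpow_pos_of_pos hx0 (ν / 2 + 1/4 : ℝ)
      have hq := pos x ⟨hx.1.le, hx.2⟩
      simp only
      rw [crossW_root hν hx0, show -x / (16 * Pnu ν) = c1 * x by simp only [c1]; ring]
      simp only [K1]
      field_simp)
  -- the pair f, g
  let c2 : ℝ := 1 / 16 * (1 / Pnu μ - 1 / Pnu ν)
  let K2 : ℝ := (2 : ℝ) ^ (2 * ν) * Real.Gamma (ν + 1) * Real.Gamma (ν + 2) /
      ((2 : ℝ) ^ (2 * μ) * Real.Gamma (μ + 1) * Real.Gamma (μ + 2))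
  have hK2 : 0 < K2 := by positivity
  let G : ℝ → ℝ := fun x => K2 * (Real.exp (c2 * x) * phi μ x / phi ν x)
  let f : ℝ → ℝ := fun x => c2 + (LD μ x - LD ν x)
  have hGA : ∀ x ∈ Ico 0 ρ, AnalyticAt ℝ G x := fun x hx =>
    analyticAt_const.mul (((lin c2 x).mul (phi_analytic hμ x)).div (phi_analytic hν x) (nz x hx))
  have hfA : ∀ x, phi ν x ≠ 0 → phi μ x ≠ 0 → AnalyticAt ℝ f x := fun x h1 h2 =>
    analyticAt_const.add ((LD_analytic hμ h2).sub (LD_analytic hν h1))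
  have hd : ∀ x, phi ν x ≠ 0 → phi μ x ≠ 0 → deriv G =ᶠ[nhds x] fun y => f y * G y := by
    intro x h1 h2
    filter_upwards [phi_ev_ne hν h1, phi_ev_ne hμ h2] with y hy hy'
    simp only [G, f]
    refine (((((dlin c2 y).mul (phi_deriv_at hμ hy')).div
      (phi_deriv_at hν hy) hy).const_mul K2).deriv).trans ?_
    simp only [Pi.mul_apply]
    field_simp
    ring
  have hft : ∀ k, 0 ≤ PowerSeries.coeff k (tay f) := by
    intro k
    simp only [f]
    rw [tay_add (g := fun x => LD μ x - LD ν x) analyticAt_const ((LD_analytic hμ h0μ).sub (LD_analytic hν h0ν)),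
      tay_sub (LD_analytic hμ h0μ) (LD_analytic hν h0ν), tay_const, LD_tay hν, LD_tay hμ,
        map_add, map_sub, map_neg, map_neg, PowerSeries.coeff_C]
    split_ifs with hk
    · rw [hk, US0, US0]; simp only [c2]; apply le_of_eq; field_simp; ring
    · have := dom k; linarith
  have hG0 : G 0 = K2 := by simp [G, phi_zero]
  have hGd := am_propagate hGA (am_of_logDeriv (hfA 0 h0ν h0μ) (hGA 0 z) (hd 0 h0ν h0μ)
    (by rw [hG0]; exact hK2.le) (deriv_nonneg_of_tay hft))
  have hGmono : MonotoneOn G (Ico 0 ρ) := by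
    apply monotoneOn_of_deriv_nonneg (convex_Ico 0 ρ)
      (fun x hx => (hGA x hx).continuousAt.continuousWithinAt)
    · intro x hx
      exact (hGA x (interior_subset hx)).differentiableAt.differentiableWithinAt
    · intro x hx
      simpa using hGd x (interior_subset hx) 1
  have hGpos : ∀ x ∈ Ico 0 ρ, 0 < G x := fun x hx =>
    lt_of_lt_of_le (by rw [hG0]; exact hK2) (hGmono z hx hx.1)
  have nzμ : ∀ x ∈ Ico 0 ρ, phi μ x ≠ 0 := by
    intro x hx h
    have := hGpos x hx
    simp [G, h] at this
  have H2 := finish (f := f) (G := G)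
    (raw := fun x => x ^ ((ν - μ) / 2) * Real.exp (x / 16 * (1 / Pnu μ - 1 / Pnu ν)) *
      crossW μ (x ^ (1/4 : ℝ)) / crossW ν (x ^ (1/4 : ℝ))) hρ
    (fun x hx => hfA x (nz x hx) (nzμ x hx)) hGA (fun x hx => hd x (nz x hx) (nzμ x hx)) hGpos
    (by simp only [f, LD_zero hν, LD_zero hμ, c2]; field_simp; ring) hft
    (by
      intro x hx
      have hx0 : 0 < x := hx.1
      have hp := Real.rpow_pos_of_pos hx0 (ν / 2 + 1/4 : ℝ)
      have hq := pos x ⟨hx.1.le, hx.2⟩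
      have hpow : x ^ ((ν - μ) / 2) * x ^ (μ / 2 + 1/4 : ℝ) = x ^ (ν / 2 + 1/4 : ℝ) := by
        rw [← Real.rpow_add hx0]; congr 1; ring
      simp only [G]
      rw [crossW_root hν hx0, crossW_root hμ hx0,
        show x / 16 * (1 / Pnu μ - 1 / Pnu ν) = c2 * x by simp only [c2]; ring, ← hpow]
      have hp1 := Real.rpow_pos_of_pos hx0 ((ν - μ) / 2)
      have hp2 := Real.rpow_pos_of_pos hx0 (μ / 2 + 1/4 : ℝ)
      simp only [K2]
      field_simp)
  rw [hG0] at H2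
  have e1 : K1 * (Real.exp (c1 * 0) / phi ν 0) = K1 := by simp [phi_zero]
  simp only [e1] at H1
  exact ⟨H2.1, H2.2, H1.1, H1.2⟩
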